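/- Let n ≥ 1, ε ∈ {-1,1}^{2n}_+, and let {(l^ε_h, r^ε_h)}_{h=1}^n be the unique element of NCPP(2n, ε). Then the cardinality of PP(2n, ε) equals ∏_{h=1}^n (2h − l^ε_h). -/

import Mathlib

/-- The family `{(l h, r h)}_{h=1}^n` is a pair partition of `{1,…,2n}`. -/
def IsPPFam (n : ℕ) (l r : Fin n → ℕ) : Prop :=
  (∀ h, l h < r h) ∧ StrictMono l ∧
    Finset.image l Finset.univ ∪ Finset.image r Finset.univ = Finset.Icc 1 (2 * n)

/-- The pair partition `{(l h, r h)}_{h=1}^n` is non-crossing. -/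
def IsNCFam (n : ℕ) (l r : Fin n → ℕ) : Prop :=
  ∀ k h : Fin n, k < h → ((l k < l h ∧ l h < r k) ↔ (l k < r h ∧ r h < r k))

/-- Choosing an injective selector of a nested family of finite sets from the smallest set to the
largest one, each choice excludes exactly one element from all the later ones. -/
theorem card_injective_piFinset_of_antitone (n : ℕ) (A : Fin n → Finset ℕ) (hA : Antitone A) :
    ((Fintype.piFinset A).filter Function.Injective).card =
      ∏ h : Fin n, ((A h).card - (n - 1 - h)) := by
  induction n with
  | zero => simp [Finset.filter_true_of_mem, Function.injective_of_subsingleton]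
  | succ n ih =>
    have hsigma : ((Fintype.piFinset A).filter Function.Injective).card =
        (((Fintype.piFinset (Fin.tail A)).filter Function.Injective).sigma
          fun s => A 0 \ Finset.image s Finset.univ).card := by
      refine Finset.card_nbij' (fun f => ⟨Fin.tail f, f 0⟩) (fun p => Fin.cons p.2 p.1)
        ?_ ?_ ?_ ?_
      · intro f hf
        simp only [Finset.coe_filter, Fintype.mem_piFinset, Set.mem_ofPred_eq] at hf
        simp only [Finset.coe_sigma, Set.mem_sigma_iff, Finset.mem_coe, Finset.mem_filter,
          Fintype.mem_piFinset, Finset.mem_sdiff, Finset.mem_image, Finset.mem_univ, true_and]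
        refine ⟨⟨fun i => hf.1 i.succ, hf.2.comp (Fin.succ_injective n)⟩, hf.1 0, ?_⟩
        rintro ⟨i, hi⟩
        exact Fin.succ_ne_zero i (hf.2 hi)
      · rintro ⟨s, a⟩ hp
        simp only [Finset.coe_sigma, Set.mem_sigma_iff, Finset.mem_coe, Finset.mem_filter,
          Fintype.mem_piFinset, Finset.mem_sdiff, Finset.mem_image, Finset.mem_univ,
          true_and] at hp
        simp only [Finset.coe_filter, Fintype.mem_piFinset, Set.mem_ofPred_eq]
        refine ⟨Fin.cases hp.2.1 fun i => hp.1.1 i, Fin.cons_injective_iff.2 ⟨?_, hp.1.2⟩⟩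
        simpa using hp.2.2
      · intro f _
        simp
      · intro p _
        simp
    have hfiber : ∀ s ∈ (Fintype.piFinset (Fin.tail A)).filter Function.Injective,
        (A 0 \ Finset.image s Finset.univ).card = (A 0).card - n := by
      intro s hs
      simp only [Finset.mem_filter, Fintype.mem_piFinset] at hs
      rw [Finset.card_sdiff_of_subset, Finset.card_image_of_injective _ hs.2, Finset.card_univ,
        Fintype.card_fin]
      intro x hx
      obtain ⟨i, -, rfl⟩ := Finset.mem_image.1 hx
      exact hA (Fin.zero_le i.succ) (hs.1 i)
    rw [hsigma, Finset.card_sigma, Finset.sum_congr rfl hfiber, Finset.sum_const, smul_eq_mul,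
      ih (Fin.tail A) fun i j hij => hA (Fin.succ_le_succ_iff.2 hij), Fin.prod_univ_succ, mul_comm]
    congr 1
    refine Finset.prod_congr rfl fun i _ => ?_
    have hi := i.isLt
    simp only [Fin.tail, Fin.val_succ]
    congr 1
    omega

/-- The points of `Icc 1 m` above `l h`, split into those outside and those inside the range
of `l`. -/
theorem card_filter_sdiff_image_of_strictMono {n m : ℕ} {l : Fin n → ℕ} (hl : StrictMono l)
    (hsub : Finset.image l Finset.univ ⊆ Finset.Icc 1 m) (h : Fin n) :
    ((Finset.Icc 1 m \ Finset.image l Finset.univ).filter (l h < ·)).card + (n - 1 - h) =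
      m - l h := by
  rw [← Fin.card_Ioi, ← Finset.card_image_of_injective (Finset.Ioi h) hl.injective,
    ← Finset.card_union_of_disjoint, ← Nat.card_Ioc]
  · congr 1
    ext x
    simp only [Finset.mem_union, Finset.mem_filter, Finset.mem_sdiff, Finset.mem_Icc,
      Finset.mem_image, Finset.mem_univ, true_and, Finset.mem_Ioi, Finset.mem_Ioc]
    constructor
    · rintro (hx | ⟨i, hi, rfl⟩)
      · exact ⟨hx.2, hx.1.1.2⟩
      · exact ⟨hl hi,
          (Finset.mem_Icc.1 (hsub (Finset.mem_image_of_mem l (Finset.mem_univ i)))).2⟩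
    · rintro ⟨h1, h2⟩
      by_cases hx : ∃ i, l i = x
      · obtain ⟨i, rfl⟩ := hx
        exact Or.inr ⟨i, hl.lt_iff_lt.1 h1, rfl⟩
      · exact Or.inl ⟨⟨⟨by omega, h2⟩, hx⟩, h1⟩
  · rw [Finset.disjoint_left]
    intro x hx hx'
    obtain ⟨i, -, rfl⟩ := Finset.mem_image.1 hx'
    exact (Finset.mem_sdiff.1 (Finset.mem_filter.1 hx).1).2
      (Finset.mem_image_of_mem l (Finset.mem_univ i))

/-- Given increasing left endpoints, the right endpoints of a pair partition are the injective
enumerations of the complement lying above the left endpoints. -/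
theorem isPPFam_iff_of_strictMono {n : ℕ} {l : Fin n → ℕ} (hl : StrictMono l)
    (hsub : Finset.image l Finset.univ ⊆ Finset.Icc 1 (2 * n)) (r : Fin n → ℕ) :
    IsPPFam n l r ↔ (∀ h, r h ∈
      (Finset.Icc 1 (2 * n) \ Finset.image l Finset.univ).filter (l h < ·)) ∧
      Function.Injective r := by
  have hcl : (Finset.image l Finset.univ).card = n := by
    simp [Finset.card_image_of_injective _ hl.injective]
  have hcr : (Finset.image r Finset.univ).card ≤ n := by
    simpa using Finset.card_image_le (s := Finset.univ) (f := r)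
  constructor
  · rintro ⟨hlt, -, hun⟩
    have hcard := Finset.card_union_add_card_inter
      (Finset.image l Finset.univ) (Finset.image r Finset.univ)
    rw [hun, Nat.card_Icc, hcl] at hcard
    have hdisj : Finset.image l Finset.univ ∩ Finset.image r Finset.univ = ∅ := by
      rw [← Finset.card_eq_zero]
      omega
    refine ⟨fun h => ?_, ?_⟩
    · have hr : r h ∈ Finset.image r Finset.univ :=
        Finset.mem_image_of_mem r (Finset.mem_univ h)
      rw [Finset.mem_filter, Finset.mem_sdiff]
      refine ⟨⟨hun ▸ Finset.mem_union_right _ hr, fun hx => ?_⟩, hlt h⟩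
      have hmem := Finset.mem_inter.2 ⟨hx, hr⟩
      simp [hdisj] at hmem
    · rw [← Set.injOn_univ, ← Finset.coe_univ, ← Finset.card_image_iff, Finset.card_univ,
        Fintype.card_fin]
      omega
  · rintro ⟨hr, hinj⟩
    refine ⟨fun h => (Finset.mem_filter.1 (hr h)).2, hl, ?_⟩
    have himage : Finset.image r Finset.univ =
        Finset.Icc 1 (2 * n) \ Finset.image l Finset.univ := by
      refine Finset.eq_of_subset_of_card_le ?_ ?_
      · intro x hx
        obtain ⟨i, -, rfl⟩ := Finset.mem_image.1 hx
        exact (Finset.mem_filter.1 (hr i)).1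
      · rw [Finset.card_sdiff_of_subset hsub, hcl, Nat.card_Icc,
          Finset.card_image_of_injective _ hinj, Finset.card_univ, Fintype.card_fin]
        omega
    rw [himage, Finset.union_sdiff_of_subset hsub]

/-- Let `n ≥ 1`, `ε ∈ {-1,1}^{2n}_+`, and let `{(l' h, r' h)}` be the (unique) element of
`NCPP(2n, ε)`.  Then the cardinality of `PP(2n, ε)` equals `∏_{h=1}^n (2h − l' h)`. -/
theorem stmt3 (n : ℕ) (hn : 1 ≤ n) (ε : ℕ → ℤ)
    (hval : ∀ v ∈ Finset.Icc 1 (2 * n), ε v = 1 ∨ ε v = -1)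
    (hsum : ∑ v ∈ Finset.Icc 1 (2 * n), ε v = 0)
    (htail : ∀ p ∈ Finset.Icc 1 (2 * n), 0 ≤ ∑ h ∈ Finset.Icc p (2 * n), ε h)
    (l' r' : Fin n → ℕ)
    (hpp' : IsPPFam n l' r')
    (hleft' : Finset.image l' Finset.univ =
      ((Finset.Icc 1 (2 * n)).filter fun v => ε v = -1))
    (hnc' : IsNCFam n l' r') :
    Set.ncard {lr : (Fin n → ℕ) × (Fin n → ℕ) |
        IsPPFam n lr.1 lr.2 ∧
        Finset.image lr.1 Finset.univ =
          ((Finset.Icc 1 (2 * n)).filter fun v => ε v = -1)} =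
      ∏ h : Fin n, (2 * ((h : ℕ) + 1) - l' h) := by
  have hl := hpp'.2.1
  have hsub : Finset.image l' Finset.univ ⊆ Finset.Icc 1 (2 * n) :=
    hleft' ▸ Finset.filter_subset _ _
  let A : Fin n → Finset ℕ := fun h =>
    (Finset.Icc 1 (2 * n) \ Finset.image l' Finset.univ).filter (l' h < ·)
  have hA : Antitone A := fun i j hij =>
    Finset.monotone_filter_right _ fun x _ hx => (hl.monotone hij).trans_lt hx
  have hset : {lr : (Fin n → ℕ) × (Fin n → ℕ) |
        IsPPFam n lr.1 lr.2 ∧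
        Finset.image lr.1 Finset.univ =
          ((Finset.Icc 1 (2 * n)).filter fun v => ε v = -1)} =
      Prod.mk l' '' ((Fintype.piFinset A).filter Function.Injective : Finset (Fin n → ℕ)) := by
    ext ⟨l, r⟩
    simp only [Set.mem_ofPred_eq, Set.mem_image, Prod.mk.injEq, Finset.coe_filter,
      Fintype.mem_piFinset, A]
    constructor
    · rintro ⟨hpp, hleft⟩
      have hll : l' = l := by
        rw [← hl.range_inj hpp.2.1]
        simpa using congrArg (fun s : Finset ℕ => (s : Set ℕ)) (hleft'.trans hleft.symm)
      subst hll
      exact ⟨r, (isPPFam_iff_of_strictMono hl hsub r).1 hpp, rfl, rfl⟩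
    · rintro ⟨_, hr, rfl, rfl⟩
      exact ⟨(isPPFam_iff_of_strictMono hl hsub _).2 hr, hleft'⟩
  rw [hset, Set.ncard_image_of_injective _ (Prod.mk_right_injective l'), Set.ncard_coe_finset,
    card_injective_piFinset_of_antitone n A hA]
  refine Finset.prod_congr rfl fun h _ => ?_
  have hcard : (A h).card + (n - 1 - h) = 2 * n - l' h :=
    card_filter_sdiff_image_of_strictMono hl hsub h
  have hlt := h.isLt
  omega
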